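/- Let H₀ and H be n×n Hermitian complex matrices. Then ∫_ℝ |N_H(t) − N_{H₀}(t)| dt ≤ Σ_{i=1}^n |λᵢ(H − H₀)|, i.e. the L¹-norm of the spectral shift function ξ = N_H − N_{H₀} is bounded by the trace norm of the perturbation V = H − H₀. -/

import Mathlib

open MeasureTheory Matrix

/-- Eigenvalue counting function `N_A(t) = #{i : λᵢ(A) > t}` of a Hermitian matrix `A`. -/
noncomputable def countingFunction {n : ℕ} {A : Matrix (Fin n) (Fin n) ℂ}
    (hA : A.IsHermitian) (t : ℝ) : ℕ :=
  Nat.card {i : Fin n // t < hA.eigenvalues i}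

section

open scoped ComplexOrder

namespace Matrix.IsHermitian

variable {n : ℕ} {A B : Matrix (Fin n) (Fin n) ℂ}

/-- The coordinates of a vector in the eigenvector basis of a Hermitian matrix. -/
noncomputable def eigenCoord (hA : A.IsHermitian) : (Fin n → ℂ) →ₗ[ℂ] (Fin n → ℂ) :=
  (star (hA.eigenvectorUnitary : Matrix (Fin n) (Fin n) ℂ)).mulVecLin

lemma star_eigenCoord (hA : A.IsHermitian) (x : Fin n → ℂ) :
    star (hA.eigenCoord x) = star x ᵥ* (hA.eigenvectorUnitary : Matrix (Fin n) (Fin n) ℂ) := by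
  simp [eigenCoord, star_mulVec, star_eq_conjTranspose]

lemma dotProduct_star_eigenCoord (hA : A.IsHermitian) (x : Fin n → ℂ) :
    star x ⬝ᵥ x = star (hA.eigenCoord x) ⬝ᵥ hA.eigenCoord x := by
  rw [star_eigenCoord, ← dotProduct_mulVec, eigenCoord, mulVecLin_apply, mulVec_mulVec,
    Unitary.mul_star_self_of_mem hA.eigenvectorUnitary.2, one_mulVec]

lemma dotProduct_mulVec_eq_eigenCoord (hA : A.IsHermitian) (x : Fin n → ℂ) :
    star x ⬝ᵥ A *ᵥ x =
      star (hA.eigenCoord x) ⬝ᵥ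
        diagonal (fun i ↦ (hA.eigenvalues i : ℂ)) *ᵥ hA.eigenCoord x := by
  conv_lhs => rw [hA.spectral_theorem, Unitary.conjStarAlgAut_apply]
  rw [star_eigenCoord, ← dotProduct_mulVec, eigenCoord, mulVecLin_apply, mulVec_mulVec,
    mulVec_mulVec]
  simp [Function.comp_def]

lemma eigenCoord_injective (hA : A.IsHermitian) : Function.Injective hA.eigenCoord := by
  rw [injective_iff_map_eq_zero]
  intro x hx
  rw [← dotProduct_star_self_eq_zero, hA.dotProduct_star_eigenCoord, hx, dotProduct_zero]

lemma re_dotProduct_mulVec_sub (hA : A.IsHermitian) (t : ℝ) (x : Fin n → ℂ) :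
    (star x ⬝ᵥ A *ᵥ x).re - t * (star x ⬝ᵥ x).re =
      ∑ i, (hA.eigenvalues i - t) * Complex.normSq (hA.eigenCoord x i) := by
  rw [hA.dotProduct_mulVec_eq_eigenCoord, hA.dotProduct_star_eigenCoord x]
  simp only [dotProduct, mulVec_diagonal, Complex.re_sum, Finset.mul_sum,
    ← Finset.sum_sub_distrib]
  refine Finset.sum_congr rfl fun i _ ↦ ?_
  simp [Complex.normSq_apply]
  ring

end Matrix.IsHermitian

/-- Monotonicity of the eigenvalue counting function in the Loewner order. -/
lemma countingFunction_mono {n : ℕ} {A B : Matrix (Fin n) (Fin n) ℂ}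
    (hA : A.IsHermitian) (hB : B.IsHermitian) (hAB : (B - A).PosSemidef) (t : ℝ) :
    countingFunction hA t ≤ countingFunction hB t := by
  classical
  let restrict (p : Fin n → Prop) : (Fin n → ℂ) →ₗ[ℂ] ({i // p i} → ℂ) :=
    LinearMap.funLeft ℂ ℂ Subtype.val
  let φ : (Fin n → ℂ) →ₗ[ℂ]
      ({i // ¬ t < hA.eigenvalues i} → ℂ) × ({i // t < hB.eigenvalues i} → ℂ) :=
    (restrict _ ∘ₗ hA.eigenCoord).prod (restrict _ ∘ₗ hB.eigenCoord)
  have hφ : Function.Injective φ := by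
    rw [injective_iff_map_eq_zero]
    intro x hx
    have hc (i : Fin n) (hi : ¬ t < hA.eigenvalues i) : hA.eigenCoord x i = 0 :=
      congrFun (congrArg Prod.fst hx) ⟨i, hi⟩
    have hd (i : Fin n) (hi : t < hB.eigenvalues i) : hB.eigenCoord x i = 0 :=
      congrFun (congrArg Prod.snd hx) ⟨i, hi⟩
    have hquad : (star x ⬝ᵥ A *ᵥ x).re ≤ (star x ⬝ᵥ B *ᵥ x).re := by
      have := (Complex.le_def.1 (hAB.dotProduct_mulVec_nonneg x)).1
      rw [sub_mulVec, dotProduct_sub, Complex.sub_re, Complex.zero_re] at this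
      linarith
    have hAsum := hA.re_dotProduct_mulVec_sub t x
    have hBsum := hB.re_dotProduct_mulVec_sub t x
    have hBnonpos : ∑ i, (hB.eigenvalues i - t) * Complex.normSq (hB.eigenCoord x i) ≤ 0 := by
      refine Finset.sum_nonpos fun i _ ↦ ?_
      by_cases hi : t < hB.eigenvalues i
      · simp [hd i hi]
      · exact mul_nonpos_of_nonpos_of_nonneg (by linarith) (Complex.normSq_nonneg _)
    have hAnonneg (i : Fin n) (_ : i ∈ Finset.univ) :
        0 ≤ (hA.eigenvalues i - t) * Complex.normSq (hA.eigenCoord x i) := by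
      by_cases hi : t < hA.eigenvalues i
      · exact mul_nonneg (by linarith) (Complex.normSq_nonneg _)
      · simp [hc i hi]
    have hAzero := (Finset.sum_eq_zero_iff_of_nonneg hAnonneg).1
      (le_antisymm (by linarith) (Finset.sum_nonneg hAnonneg))
    apply hA.eigenCoord_injective
    rw [map_zero]
    funext i
    by_cases hi : t < hA.eigenvalues i
    · have := (mul_eq_zero.1 (hAzero i (Finset.mem_univ i))).resolve_left (by linarith)
      exact Complex.normSq_eq_zero.1 this
    · exact hc i hi
  have hrank := LinearMap.finrank_le_finrank_of_injective hφ
  have hcompl := Fintype.card_subtype_compl (fun i ↦ t < hA.eigenvalues i)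
  have hle := Fintype.card_subtype_le (fun i ↦ t < hA.eigenvalues i)
  simp only [Module.finrank_prod, Module.finrank_fintype_fun_eq_card] at hrank
  simp only [countingFunction, Nat.card_eq_fintype_card]
  omega

lemma ite_sub_ite_eq_indicator (a b t : ℝ) :
    (if t < b then (1 : ℝ) else 0) - (if t < a then 1 else 0) =
      (Set.Ico a b).indicator 1 t - (Set.Ico b a).indicator 1 t := by
  simp only [Set.indicator_apply, Set.mem_Ico, Pi.one_apply]
  split_ifs <;> grind

lemma countingFunction_eq_sum {n : ℕ} {A : Matrix (Fin n) (Fin n) ℂ}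
    (hA : A.IsHermitian) (t : ℝ) :
    (countingFunction hA t : ℝ) = ∑ i, if t < hA.eigenvalues i then (1 : ℝ) else 0 := by
  classical
  simp [countingFunction, Fintype.card_subtype]

lemma countingFunction_sub {n : ℕ} {A B : Matrix (Fin n) (Fin n) ℂ}
    (hA : A.IsHermitian) (hB : B.IsHermitian) (t : ℝ) :
    (countingFunction hB t : ℝ) - countingFunction hA t =
      ∑ i, ((Set.Ico (hA.eigenvalues i) (hB.eigenvalues i)).indicator (1 : ℝ → ℝ) t -
        (Set.Ico (hB.eigenvalues i) (hA.eigenvalues i)).indicator (1 : ℝ → ℝ) t) := by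
  simp only [countingFunction_eq_sum, ← Finset.sum_sub_distrib, ite_sub_ite_eq_indicator]

lemma integrable_indicator_Ico_one (a b : ℝ) :
    Integrable ((Set.Ico a b).indicator (1 : ℝ → ℝ)) := by
  rw [integrable_indicator_iff measurableSet_Ico]
  exact integrableOn_const (by simp) (by simp)

lemma integrable_countingFunction_sub {n : ℕ} {A B : Matrix (Fin n) (Fin n) ℂ}
    (hA : A.IsHermitian) (hB : B.IsHermitian) :
    Integrable fun t ↦ (countingFunction hB t : ℝ) - countingFunction hA t := by
  simp only [countingFunction_sub]
  exact integrable_finsetSum _ fun i _ ↦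
    (integrable_indicator_Ico_one _ _).sub (integrable_indicator_Ico_one _ _)

lemma integral_countingFunction_sub {n : ℕ} {A B : Matrix (Fin n) (Fin n) ℂ}
    (hA : A.IsHermitian) (hB : B.IsHermitian) :
    ∫ t, ((countingFunction hB t : ℝ) - countingFunction hA t) = (B - A).trace.re := by
  simp only [countingFunction_sub]
  have hint (a b : ℝ) : Integrable fun t ↦
      (Set.Ico a b).indicator (1 : ℝ → ℝ) t - (Set.Ico b a).indicator (1 : ℝ → ℝ) t :=
    (integrable_indicator_Ico_one _ _).sub (integrable_indicator_Ico_one _ _)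
  rw [integral_finsetSum _ fun i _ ↦ hint _ _, trace_sub, hA.trace_eq_sum_eigenvalues,
    hB.trace_eq_sum_eigenvalues,
    ← Finset.sum_sub_distrib, Complex.re_sum]
  refine Finset.sum_congr rfl fun i _ ↦ ?_
  rw [integral_sub (integrable_indicator_Ico_one _ _) (integrable_indicator_Ico_one _ _),
    integral_indicator_one measurableSet_Ico, integral_indicator_one measurableSet_Ico,
    Real.volume_real_Ico, Real.volume_real_Ico]
  simp
  grind

/-- Jordan decomposition of a Hermitian matrix, with the trace norm as sum of the traces. -/
lemma Matrix.IsHermitian.exists_posSemidef_sub {n : ℕ} {V : Matrix (Fin n) (Fin n) ℂ}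
    (hV : V.IsHermitian) :
    ∃ P Q : Matrix (Fin n) (Fin n) ℂ, P.PosSemidef ∧ Q.PosSemidef ∧ V = P - Q ∧
      P.trace.re + Q.trace.re = ∑ i, |hV.eigenvalues i| := by
  let U : Matrix (Fin n) (Fin n) ℂ := hV.eigenvectorUnitary
  have hU : Uᴴ * U = 1 := Unitary.coe_star_mul_self hV.eigenvectorUnitary
  let conj (d : Fin n → ℝ) : Matrix (Fin n) (Fin n) ℂ := U * diagonal (fun i ↦ (d i : ℂ)) * Uᴴ
  have hpos (d : Fin n → ℝ) (hd : 0 ≤ d) : (conj d).PosSemidef :=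
    (PosSemidef.diagonal fun i ↦ by simpa using hd i).mul_mul_conjTranspose_same U
  have htrace (d : Fin n → ℝ) : (conj d).trace.re = ∑ i, d i := by
    simp only [conj]
    rw [trace_mul_comm, ← mul_assoc, hU, one_mul, trace_diagonal, Complex.re_sum]
    rfl
  refine ⟨conj hV.eigenvalues⁺, conj hV.eigenvalues⁻, hpos _ (posPart_nonneg _),
    hpos _ (negPart_nonneg _), ?_, ?_⟩
  · conv_lhs => rw [hV.spectral_theorem, Unitary.conjStarAlgAut_apply]
    simp only [conj]
    rw [← sub_mul, ← mul_sub, diagonal_sub]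
    congr! 4 with i
    rw [← Complex.ofReal_sub, ← Pi.sub_apply, posPart_sub_negPart]
    rfl
  · rw [htrace, htrace, ← Finset.sum_add_distrib]
    refine Finset.sum_congr rfl fun i _ ↦ ?_
    rw [← Pi.add_apply, posPart_add_negPart, Pi.abs_apply]

end

/-- For Hermitian matrices `H₀, H`, the `L¹`-norm of the spectral shift
function `ξ = N_H − N_{H₀}` is bounded by the trace norm of `V = H − H₀`:
`∫_ℝ |N_H(t) − N_{H₀}(t)| dt ≤ Σᵢ |λᵢ(H − H₀)|`. -/
theorem statement8 {n : ℕ} {H₀ H : Matrix (Fin n) (Fin n) ℂ}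
    (hH₀ : H₀.IsHermitian) (hH : H.IsHermitian) :
    ∫ t : ℝ, |(countingFunction hH t : ℝ) - (countingFunction hH₀ t : ℝ)|
      ≤ ∑ i, |(hH.sub hH₀).eigenvalues i| := by
  obtain ⟨P, Q, hP, hQ, hV, htrace⟩ := (hH.sub hH₀).exists_posSemidef_sub
  have hK : (H₀ + P).IsHermitian := hH₀.add hP.1
  have hKH₀ : H₀ + P - H₀ = P := by abel
  have hKH : H₀ + P - H = Q := by
    rw [sub_eq_iff_eq_add] at hV
    rw [hV]
    abel
  have hint₀ := integrable_countingFunction_sub hH₀ hK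
  have hint := integrable_countingFunction_sub hH hK
  calc
    _ ≤ ∫ t, (((countingFunction hK t : ℝ) - countingFunction hH₀ t) +
          ((countingFunction hK t : ℝ) - countingFunction hH t)) := by
      refine integral_mono (integrable_countingFunction_sub hH₀ hH).abs (hint₀.add hint)
        fun t ↦ ?_
      have h₀ : (countingFunction hH₀ t : ℝ) ≤ countingFunction hK t :=
        mod_cast countingFunction_mono hH₀ hK (by rwa [hKH₀]) t
      have h₁ : (countingFunction hH t : ℝ) ≤ countingFunction hK t :=
        mod_cast countingFunction_mono hH hK (by rwa [hKH]) t
      exact abs_le.2 ⟨by linarith, by linarith⟩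
    _ = ∑ i, |(hH.sub hH₀).eigenvalues i| := by
      rw [integral_add hint₀ hint, integral_countingFunction_sub, integral_countingFunction_sub,
        hKH₀, hKH, htrace]
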